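/- Assume the standing hypotheses on g₀, g₁, …, g_m and the compact sets U, V and fix x̄₀, ū₀, T > 0. Let u : [0,T) → U be absolutely continuous on [0,t] for every t < T with u(0)=ū₀, let v : [0,T) → V be Borel measurable, and let x be the Carathéodory solution corresponding to (u,v). Define σ(t) := ∫₀ᵗ (1+|u̇(τ)|) dτ for t ∈ [0,T), S := lim_{t→T} σ(t) ≤ +∞, φ₀ := σ⁻¹ : [0,S) → [0,T), φ := u∘φ₀, ψ := v∘φ₀, and let ξ be the space-time solution with initial datum x̄₀ corresponding to (φ₀,φ,ψ). Then (φ₀,φ) is 1-Lipschitz, φ₀ is strictly increasing with φ₀(0)=0 and φ₀'(s)+|φ'(s)| = 1 for a.e. s ∈ [0,S), lim_{s→S} φ₀(s) = T, and (ξ(σ(t)),φ(σ(t)),ψ(σ(t))) = (x(t),u(t),v(t)) for every t ∈ [0,T). -/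

import Mathlib

open MeasureTheory Set Filter Topology
open scoped ENNReal

noncomputable section

/-- `f` is absolutely continuous on `[0,t]` for every `t < T`. -/
def ACloc {E : Type*} [NormedAddCommGroup E] [NormedSpace ℝ E] (f : ℝ → E) (T : ℝ) : Prop :=
  ∀ t ∈ Ico (0:ℝ) T, IntervalIntegrable (deriv f) volume 0 t ∧
    ∀ τ ∈ Icc (0:ℝ) t, f τ = f 0 + ∫ r in (0:ℝ)..τ, deriv f r

/-- Standing hypotheses on the data of the impulsive control system. -/
def StandingHyp {n m q : ℕ} (U : Set (EuclideanSpace ℝ (Fin m)))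
    (V : Set (EuclideanSpace ℝ (Fin q)))
    (g0 : EuclideanSpace ℝ (Fin n) → EuclideanSpace ℝ (Fin m) → EuclideanSpace ℝ (Fin q) →
      EuclideanSpace ℝ (Fin n))
    (g : Fin m → EuclideanSpace ℝ (Fin n) → EuclideanSpace ℝ (Fin m) →
      EuclideanSpace ℝ (Fin n))
    (M : ℝ) : Prop :=
  IsCompact U ∧ IsCompact V ∧
  -- g₀ continuous on ℝⁿ × U × V
  ContinuousOn (fun p : (EuclideanSpace ℝ (Fin n) × EuclideanSpace ℝ (Fin m)) ×
      EuclideanSpace ℝ (Fin q) => g0 p.1.1 p.1.2 p.2) ((univ ×ˢ U) ×ˢ V) ∧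
  -- (x,u) ↦ g₀(x,u,v) locally Lipschitz, uniformly in v ∈ V
  (∀ R > (0:ℝ), ∃ L ≥ (0:ℝ), ∀ v' ∈ V, ∀ x1 x2 : EuclideanSpace ℝ (Fin n),
    ∀ u1 ∈ U, ∀ u2 ∈ U, ‖x1‖ ≤ R → ‖x2‖ ≤ R →
      ‖g0 x1 u1 v' - g0 x2 u2 v'‖ ≤ L * (‖x1 - x2‖ + ‖u1 - u2‖)) ∧
  -- each gᵢ locally Lipschitz
  (∀ i : Fin m, ∀ R > (0:ℝ), ∃ L ≥ (0:ℝ), ∀ x1 x2 : EuclideanSpace ℝ (Fin n),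
    ∀ u1 ∈ U, ∀ u2 ∈ U, ‖x1‖ ≤ R → ‖x2‖ ≤ R →
      ‖g i x1 u1 - g i x2 u2‖ ≤ L * (‖x1 - x2‖ + ‖u1 - u2‖)) ∧
  -- sublinear growth: |(g₀,g₁,…,g_m)| ≤ M(1+|(x,u)|)
  0 < M ∧
  ∀ (x : EuclideanSpace ℝ (Fin n)), ∀ u' ∈ U, ∀ v' ∈ V,
    Real.sqrt (‖g0 x u' v'‖ ^ 2 + ∑ i, ‖g i x u'‖ ^ 2) ≤
      M * (1 + Real.sqrt (‖x‖ ^ 2 + ‖u'‖ ^ 2))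

/-- `ξ` is a space-time solution with initial datum `x0` corresponding to `(φ₀,φ,ψ)`,
on the domain `D`. -/
def IsSTSol {n m q : ℕ}
    (g0 : EuclideanSpace ℝ (Fin n) → EuclideanSpace ℝ (Fin m) → EuclideanSpace ℝ (Fin q) →
      EuclideanSpace ℝ (Fin n))
    (g : Fin m → EuclideanSpace ℝ (Fin n) → EuclideanSpace ℝ (Fin m) →
      EuclideanSpace ℝ (Fin n))
    (x0 : EuclideanSpace ℝ (Fin n)) (phi0 : ℝ → ℝ) (phi : ℝ → EuclideanSpace ℝ (Fin m))
    (psi : ℝ → EuclideanSpace ℝ (Fin q)) (xi : ℝ → EuclideanSpace ℝ (Fin n))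
    (D : Set ℝ) : Prop :=
  ∀ s ∈ D, xi s = x0 + ∫ r in (0:ℝ)..s,
    ((deriv phi0 r) • g0 (xi r) (phi r) (psi r) +
      ∑ i, ((deriv phi r) i) • g i (xi r) (phi r))

/-- `x` is a Carathéodory solution on `D` of the impulsive system, for an absolutely
continuous control `u` and a measurable control `v`, with initial datum `x0`. -/
def IsCaraSol {n m q : ℕ}
    (g0 : EuclideanSpace ℝ (Fin n) → EuclideanSpace ℝ (Fin m) → EuclideanSpace ℝ (Fin q) →
      EuclideanSpace ℝ (Fin n))
    (g : Fin m → EuclideanSpace ℝ (Fin n) → EuclideanSpace ℝ (Fin m) →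
      EuclideanSpace ℝ (Fin n))
    (x0 : EuclideanSpace ℝ (Fin n)) (u : ℝ → EuclideanSpace ℝ (Fin m))
    (v : ℝ → EuclideanSpace ℝ (Fin q)) (x : ℝ → EuclideanSpace ℝ (Fin n))
    (D : Set ℝ) : Prop :=
  ∀ t ∈ D, x t = x0 + ∫ r in (0:ℝ)..t,
    (g0 (x r) (u r) (v r) + ∑ i, ((deriv u r) i) • g i (x r) (u r))

/-- Small-interval Gronwall estimate. -/
lemma small_gronwall {a b c : ℝ} (hab : a ≤ b) (w k : ℝ → ℝ) (hw : ContinuousOn w (Icc a b))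
    (hk0 : ∀ r ∈ Icc a b, 0 ≤ k r) (hki : IntervalIntegrable k volume a b)
    (hw0 : ∀ r ∈ Icc a b, 0 ≤ w r)
    (hk : ∫ r in a..b, k r ≤ 1 / 2)
    (h : ∀ τ ∈ Icc a b, w τ ≤ c + ∫ r in a..τ, k r * w r) :
    ∀ τ ∈ Icc a b, w τ ≤ 2 * c := by
  obtain ⟨τ, hτ, hmax⟩ := isCompact_Icc.exists_isMaxOn (nonempty_Icc.2 hab) hw
  have hmax' : ∀ r ∈ Icc a b, w r ≤ w τ := fun r hr => hmax hr
  have hki' : IntervalIntegrable k volume a τ :=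
    hki.mono_set (by rw [uIcc_of_le hab, uIcc_of_le hτ.1]; exact Icc_subset_Icc_right hτ.2)
  have hsub : Icc a τ ⊆ Icc a b := Icc_subset_Icc_right hτ.2
  have h1 : ∫ r in a..τ, k r * w r ≤ ∫ r in a..τ, k r * w τ := by
    apply intervalIntegral.integral_mono_on hτ.1
    · apply hki'.mul_continuousOn
      rw [uIcc_of_le hτ.1]; exact hw.mono hsub
    · exact hki'.mul_const _
    · intro r hr
      exact mul_le_mul_of_nonneg_left (hmax' r (hsub hr)) (hk0 r (hsub hr))
  have h2 : ∫ r in a..τ, k r ≤ 1 / 2 := by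
    refine le_trans ?_ hk
    apply intervalIntegral.integral_mono_interval le_rfl hτ.1 hτ.2 _ hki
    filter_upwards [ae_restrict_mem measurableSet_Ioc] with r hr
    exact hk0 r (Ioc_subset_Icc_self hr)
  rw [intervalIntegral.integral_mul_const] at h1
  have h3 := h τ hτ
  have h4 := mul_le_mul_of_nonneg_right h2 (hw0 τ hτ)
  intro r hr
  have := hmax' r hr
  linarith

/-- Small integrals to the right of a point. -/
lemma exists_small_right {a b : ℝ} (hab : a < b) (k : ℝ → ℝ)
    (hki : IntervalIntegrable k volume a b) : ∃ d ∈ Ioc a b, ∫ r in a..d, k r ≤ 1 / 2 := by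
  have hc := intervalIntegral.continuousOn_primitive_interval' hki left_mem_uIcc
  rw [uIcc_of_le hab.le] at hc
  have h1 := hc a (left_mem_Icc.2 hab.le)
  have h2 : ∀ᶠ d in 𝓝[Icc a b] a, ∫ r in a..d, k r < 1 / 2 := by
    apply h1.eventually_lt_const; simp
  have h3 : ∀ᶠ d in 𝓝[>] a, d ∈ Ioc a b := Ioc_mem_nhdsGT hab
  have h4 : 𝓝[Ioc a b] a ≤ 𝓝[Icc a b] a := nhdsWithin_mono _ Ioc_subset_Icc_self
  rw [← nhdsWithin_Ioc_eq_nhdsGT hab] at h3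
  have : (𝓝[Ioc a b] a).NeBot := by
    rw [nhdsWithin_Ioc_eq_nhdsGT hab]; infer_instance
  obtain ⟨d, hd, hd'⟩ := (h3.and (h4 h2)).exists
  exact ⟨d, hd, hd'.le⟩

/-- Small integrals to the left of a point. -/
lemma exists_small_left {a b : ℝ} (hab : a < b) (k : ℝ → ℝ)
    (hki : IntervalIntegrable k volume a b) : ∃ d ∈ Ico a b, ∫ r in d..b, k r ≤ 1 / 2 := by
  have hc := intervalIntegral.continuousOn_primitive_interval' hki right_mem_uIcc
  rw [uIcc_of_le hab.le] at hc
  have h1 := hc b (right_mem_Icc.2 hab.le)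
  have h2 : ∀ᶠ d in 𝓝[Icc a b] b, -(1 / 2) < ∫ r in b..d, k r := by
    apply h1.eventually_const_lt; simp
  have h3 : ∀ᶠ d in 𝓝[<] b, d ∈ Ico a b := Ico_mem_nhdsLT hab
  have h4 : 𝓝[Ico a b] b ≤ 𝓝[Icc a b] b := nhdsWithin_mono _ Ico_subset_Icc_self
  rw [← nhdsWithin_Ico_eq_nhdsLT hab] at h3
  have : (𝓝[Ico a b] b).NeBot := by
    rw [nhdsWithin_Ico_eq_nhdsLT hab]; infer_instance
  obtain ⟨d, hd, hd'⟩ := (h3.and (h4 h2)).exists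
  refine ⟨d, hd, ?_⟩
  rw [intervalIntegral.integral_symm]; linarith

section abstractODE
variable {E : Type*} [NormedAddCommGroup E] [NormedSpace ℝ E]

/-- A (possibly junk-valued) integral solution has an integrable right-hand side. -/
lemma sol_integrable (F : ℝ → E → E) (k : ℝ → ℝ) (T : ℝ) (x0 : E)
    (hmeas : ∀ t ∈ Ico (0:ℝ) T, ∀ y : ℝ → E,
      AEStronglyMeasurable y (volume.restrict (Ioc 0 t)) →
      AEStronglyMeasurable (fun r => F r (y r)) (volume.restrict (Ioc 0 t)))
    (hk0 : ∀ r, 0 ≤ k r) (hki : ∀ t ∈ Ico (0:ℝ) T, IntervalIntegrable k volume 0 t)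
    (hgr : ∀ r ∈ Ico (0:ℝ) T, ∀ y, ‖F r y‖ ≤ k r * (1 + ‖y‖))
    (x : ℝ → E) (hx : ∀ t ∈ Ico (0:ℝ) T, x t = x0 + ∫ r in (0:ℝ)..t, F r (x r))
    (t : ℝ) (ht : t ∈ Ico (0:ℝ) T) :
    IntervalIntegrable (fun r => F r (x r)) volume 0 t := by
  by_contra hnot
  set G : ℝ → E := fun r => F r (x r) with hG
  have hmono : ∀ a b, 0 ≤ a → a ≤ b → IntervalIntegrable G volume 0 b →
      IntervalIntegrable G volume 0 a := fun a b h0 hab h =>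
    h.mono_set (by rw [uIcc_of_le h0, uIcc_of_le (h0.trans hab)]; exact Icc_subset_Icc_right hab)
  set I : Set ℝ := {τ | τ ∈ Icc 0 t ∧ IntervalIntegrable G volume 0 τ} with hI
  have h0I : (0:ℝ) ∈ I := ⟨⟨le_rfl, ht.1⟩, by simp⟩
  have hbdd : BddAbove I := ⟨t, fun τ h => h.1.2⟩
  set t1 := sSup I with ht1
  have ht10 : 0 ≤ t1 := le_csSup hbdd h0I
  have ht1t : t1 ≤ t := csSup_le ⟨0, h0I⟩ fun τ h => h.1.2
  have hlow : ∀ τ, 0 ≤ τ → τ < t1 → IntervalIntegrable G volume 0 τ := by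
    intro τ h0 hτ
    obtain ⟨b, hb, hτb⟩ := exists_lt_of_lt_csSup ⟨0, h0I⟩ hτ
    exact hmono τ b h0 hτb.le hb.2
  have hhigh : ∀ τ ∈ Ioc t1 t, x τ = x0 := by
    intro τ hτ
    have : ¬ IntervalIntegrable G volume 0 τ := fun h =>
      absurd (le_csSup hbdd (⟨⟨ht10.trans hτ.1.le, hτ.2⟩, h⟩ : τ ∈ I)) (not_le.2 hτ.1)
    rw [hx τ ⟨ht10.trans hτ.1.le, hτ.2.trans_lt ht.2⟩, intervalIntegral.integral_undef this,
      add_zero]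
  have hcont' : ∀ b, 0 ≤ b → b < t1 → ContinuousOn x (Icc 0 b) := by
    intro b h0 hb
    have h1 := intervalIntegral.continuousOn_primitive_interval' (hlow b h0 hb) left_mem_uIcc
    rw [uIcc_of_le h0] at h1
    refine (continuousOn_const (c := x0)).add h1 |>.congr ?_
    intro τ hτ
    exact hx τ ⟨hτ.1, (hτ.2.trans hb.le).trans_lt (ht1t.trans_lt ht.2)⟩
  have hcont : ContinuousOn x (Ico 0 t1) := by
    intro τ hτ
    obtain ⟨b, hb1, hb2⟩ := exists_between hτ.2
    have := hcont' b (hτ.1.trans hb1.le) hb2 τ ⟨hτ.1, hb1.le⟩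
    refine this.mono_of_mem_nhdsWithin ?_
    have h5 : Iio b ∈ 𝓝 τ := Iio_mem_nhds hb1
    filter_upwards [self_mem_nhdsWithin, mem_nhdsWithin_of_mem_nhds h5] with z hz hz'
    exact ⟨hz.1, le_of_lt hz'⟩
  have hbd : ∃ C, ∀ τ ∈ Ico 0 t1, ‖x τ‖ ≤ C := by
    rcases ht10.eq_or_lt with h | h
    · exact ⟨0, fun τ hτ => absurd (hτ.1.trans_lt hτ.2) (by rw [← h]; simp)⟩
    have hkt1 := hki t1 ⟨ht10, ht1t.trans_lt ht.2⟩
    obtain ⟨d, hd, hdk⟩ := exists_small_left h k hkt1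
    obtain ⟨C1, hC1⟩ := isCompact_Icc.exists_bound_of_continuousOn (hcont' d hd.1 hd.2)
    refine ⟨max C1 (2 * (1 + ‖x d‖)), fun τ hτ => ?_⟩
    rcases le_total τ d with hτd | hτd
    · exact (hC1 τ ⟨hτ.1, hτd⟩).trans (le_max_left _ _)
    refine le_trans ?_ (le_max_right _ _)
    have hkdt : IntervalIntegrable k volume d t1 :=
      hkt1.mono_set (by rw [uIcc_of_le hd.2.le, uIcc_of_le ht10]; exact Icc_subset_Icc_left hd.1)
    have hkdτ : IntervalIntegrable k volume d τ :=
      hkdt.mono_set (by rw [uIcc_of_le hd.2.le, uIcc_of_le hτd]; exact Icc_subset_Icc_right hτ.2.le)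
    have hco : ContinuousOn (fun r => 1 + ‖x r‖) (Icc d τ) :=
      continuousOn_const.add ((hcont.mono fun z hz =>
        ⟨hd.1.trans hz.1, hz.2.trans_lt hτ.2⟩).norm)
    have key := small_gronwall hτd (c := 1 + ‖x d‖) (fun r => 1 + ‖x r‖) k hco (fun r _ => hk0 r)
      hkdτ (fun r _ => by positivity) ?_ ?_ τ ⟨hτd, le_rfl⟩
    · linarith
    · refine le_trans ?_ hdk
      apply intervalIntegral.integral_mono_interval le_rfl hτd hτ.2.le _ hkdt
      exact Eventually.of_forall fun r => hk0 r
    · intro r hr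
      have hr0 : 0 ≤ r := hd.1.trans hr.1
      have hrt : r < t1 := hr.2.trans_lt hτ.2
      have hGr := hlow r hr0 hrt
      have hGd := hlow d hd.1 hd.2
      have e1 : x r = x d + ∫ z in d..r, G z := by
        rw [hx r ⟨hr0, hrt.trans_le (ht1t.trans ht.2.le)⟩,
          hx d ⟨hd.1, hd.2.trans_le (ht1t.trans ht.2.le)⟩, add_assoc,
          intervalIntegral.integral_add_adjacent_intervals hGd (hGd.symm.trans hGr)]
      have e2 : ‖∫ z in d..r, G z‖ ≤ ∫ z in d..r, k z * (1 + ‖x z‖) := by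
        apply intervalIntegral.norm_integral_le_of_norm_le hr.1
        · refine Eventually.of_forall fun z hz => ?_
          exact hgr z ⟨hd.1.trans hz.1.le, (hz.2.trans_lt hrt).trans_le (ht1t.trans ht.2.le)⟩ _
        · have hkr : IntervalIntegrable k volume d r := hkdτ.mono_set
            (by rw [uIcc_of_le hr.1, uIcc_of_le hτd]; exact Icc_subset_Icc_right hr.2)
          apply hkr.mul_continuousOn
          rw [uIcc_of_le hr.1]
          exact hco.mono (Icc_subset_Icc_right hr.2)
      have e3 := norm_add_le (x d) (∫ z in d..r, G z)
      rw [← e1] at e3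
      linarith
  obtain ⟨C, hC⟩ := hbd
  have hbd2 : ∀ τ ∈ Icc 0 t, ‖x τ‖ ≤ max (max C ‖x0‖) ‖x t1‖ := by
    intro τ hτ
    rcases lt_trichotomy τ t1 with h | h | h
    · exact (hC τ ⟨hτ.1, h⟩).trans ((le_max_left _ _).trans (le_max_left _ _))
    · rw [h]; exact le_max_right _ _
    · rw [hhigh τ ⟨h, hτ.2⟩]; exact (le_max_right _ _).trans (le_max_left _ _)
  have hxm : AEStronglyMeasurable x (volume.restrict (Ioc 0 t)) := by
    have h1 : AEStronglyMeasurable x (volume.restrict (Ico 0 t1)) :=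
      hcont.aestronglyMeasurable measurableSet_Ico
    have h2 : AEStronglyMeasurable x (volume.restrict (Ioc t1 t)) := by
      refine (aestronglyMeasurable_const (b := x0)).congr ?_
      filter_upwards [ae_restrict_mem measurableSet_Ioc] with r hr
      exact (hhigh r hr).symm
    have h3 : AEStronglyMeasurable x (volume.restrict {t1}) := by
      rw [Measure.restrict_singleton]; simp
    have := (aestronglyMeasurable_union_iff.2
      ⟨h1, aestronglyMeasurable_union_iff.2 ⟨h3, h2⟩⟩)
    refine this.mono_measure (Measure.restrict_mono ?_ le_rfl)
    intro z hz
    rcases lt_trichotomy z t1 with h | h | h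
    · exact Or.inl ⟨hz.1.le, h⟩
    · exact Or.inr (Or.inl h)
    · exact Or.inr (Or.inr ⟨h, hz.2⟩)
  apply hnot
  rw [intervalIntegrable_iff_integrableOn_Ioc_of_le ht.1]
  have hkk := (hki t ht).mul_const (1 + max (max C ‖x0‖) ‖x t1‖)
  rw [intervalIntegrable_iff_integrableOn_Ioc_of_le ht.1] at hkk
  refine Integrable.mono' hkk (hmeas t ht x hxm) ?_
  filter_upwards [ae_restrict_mem measurableSet_Ioc] with r hr
  refine (hgr r ⟨hr.1.le, hr.2.trans_lt ht.2⟩ _).trans ?_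
  apply mul_le_mul_of_nonneg_left _ (hk0 r)
  have := hbd2 r ⟨hr.1.le, hr.2⟩
  linarith

/-- Uniqueness of integral solutions. -/
lemma sol_unique (F : ℝ → E → E) (k : ℝ → ℝ) (T : ℝ) (x0 : E)
    (hmeas : ∀ t ∈ Ico (0:ℝ) T, ∀ y : ℝ → E,
      AEStronglyMeasurable y (volume.restrict (Ioc 0 t)) →
      AEStronglyMeasurable (fun r => F r (y r)) (volume.restrict (Ioc 0 t)))
    (hk0 : ∀ r, 0 ≤ k r) (hki : ∀ t ∈ Ico (0:ℝ) T, IntervalIntegrable k volume 0 t)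
    (hgr : ∀ r ∈ Ico (0:ℝ) T, ∀ y, ‖F r y‖ ≤ k r * (1 + ‖y‖))
    (hlip : ∀ R > (0:ℝ), ∃ L ≥ (0:ℝ), ∀ r ∈ Ico (0:ℝ) T, ∀ y1 y2, ‖y1‖ ≤ R → ‖y2‖ ≤ R →
      ‖F r y1 - F r y2‖ ≤ L * k r * ‖y1 - y2‖)
    (x y : ℝ → E) (hx : ∀ t ∈ Ico (0:ℝ) T, x t = x0 + ∫ r in (0:ℝ)..t, F r (x r))
    (hy : ∀ t ∈ Ico (0:ℝ) T, y t = x0 + ∫ r in (0:ℝ)..t, F r (y r))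
    (t : ℝ) (ht : t ∈ Ico (0:ℝ) T) : x t = y t := by
  have hxi := sol_integrable F k T x0 hmeas hk0 hki hgr x hx
  have hyi := sol_integrable F k T x0 hmeas hk0 hki hgr y hy
  have hcont : ∀ z : ℝ → E, (∀ t ∈ Ico (0:ℝ) T, z t = x0 + ∫ r in (0:ℝ)..t, F r (z r)) →
      IntervalIntegrable (fun r => F r (z r)) volume 0 t → ContinuousOn z (Icc 0 t) := by
    intro z hz hi
    have h1 := intervalIntegral.continuousOn_primitive_interval' hi left_mem_uIcc
    rw [uIcc_of_le ht.1] at h1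
    refine (continuousOn_const (c := x0)).add h1 |>.congr ?_
    intro τ hτ
    exact hz τ ⟨hτ.1, hτ.2.trans_lt ht.2⟩
  have hcx := hcont x hx (hxi t ht)
  have hcy := hcont y hy (hyi t ht)
  obtain ⟨C1, hC1⟩ := isCompact_Icc.exists_bound_of_continuousOn hcx
  obtain ⟨C2, hC2⟩ := isCompact_Icc.exists_bound_of_continuousOn hcy
  obtain ⟨L, hL0, hL⟩ := hlip (max (max C1 C2) 1) (by positivity)
  set w : ℝ → ℝ := fun r => ‖x r - y r‖ with hw
  have hcw : ContinuousOn w (Icc 0 t) := (hcx.sub hcy).norm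
  have hinc : ∀ a b, 0 ≤ a → a ≤ b → b ≤ t → w b ≤ w a + ∫ r in a..b, (L * k r) * w r := by
    intro a b h0 hab hbt
    have ha : a ∈ Ico 0 T := ⟨h0, (hab.trans hbt).trans_lt ht.2⟩
    have hb : b ∈ Ico 0 T := ⟨h0.trans hab, hbt.trans_lt ht.2⟩
    have ix := (hxi a ha).symm.trans (hxi b hb)
    have iy := (hyi a ha).symm.trans (hyi b hb)
    have e1 : x b - y b = (x a - y a) + ∫ r in a..b, (F r (x r) - F r (y r)) := by
      rw [hx b hb, hy b hb, hx a ha, hy a ha,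
        ← intervalIntegral.integral_add_adjacent_intervals (hxi a ha) ix,
        ← intervalIntegral.integral_add_adjacent_intervals (hyi a ha) iy,
        intervalIntegral.integral_sub ix iy]
      abel
    have e2 : ‖∫ r in a..b, (F r (x r) - F r (y r))‖ ≤ ∫ r in a..b, (L * k r) * w r := by
      apply intervalIntegral.norm_integral_le_of_norm_le hab
      · refine Eventually.of_forall fun z hz => ?_
        have hz' : z ∈ Icc 0 t := ⟨h0.trans hz.1.le, hz.2.trans hbt⟩
        refine hL z ⟨hz'.1, hz'.2.trans_lt ht.2⟩ _ _ ?_ ?_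
        · exact (hC1 z hz').trans ((le_max_left _ _).trans (le_max_left _ _))
        · exact (hC2 z hz').trans ((le_max_right _ _).trans (le_max_left _ _))
      · have hkr : IntervalIntegrable k volume a b := (hki a ha).symm.trans (hki b hb)
        apply (hkr.const_mul L).mul_continuousOn
        rw [uIcc_of_le hab]
        exact hcw.mono (Icc_subset_Icc h0 hbt)
    have e3 := norm_add_le (x a - y a) (∫ r in a..b, (F r (x r) - F r (y r)))
    rw [← e1] at e3
    simp only [hw] at e2 ⊢
    linarith
  have hmain : Icc 0 t ⊆ {τ | w τ = 0} := by
    apply IsClosed.Icc_subset_of_forall_exists_gt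
    · have := hcw.preimage_isClosed_of_isClosed isClosed_Icc (isClosed_singleton (x := (0:ℝ)))
      convert this using 1
      ext z; simp [and_comm]
    · have h0 : (0:ℝ) ∈ Ico 0 T := ⟨le_rfl, ht.1.trans_lt ht.2⟩
      simp [hw, hx 0 h0, hy 0 h0]
    · rintro a ⟨ha0, ha⟩ b hb
      have hab : a < min b t := lt_min hb ha.2
      have hm : min b t ∈ Ico 0 T := ⟨ha.1.trans hab.le, (min_le_right _ _).trans_lt ht.2⟩
      have hkr : IntervalIntegrable (fun r => L * k r) volume a (min b t) :=
        ((hki a ⟨ha.1, ha.2.trans ht.2⟩).symm.trans (hki _ hm)).const_mul L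
      obtain ⟨d, hd, hdk⟩ := exists_small_right hab _ hkr
      have hdt : d ≤ t := hd.2.trans (min_le_right _ _)
      refine ⟨d, ?_, hd.1, hd.2.trans (min_le_left _ _)⟩
      have key := small_gronwall hd.1.le (c := 0) w (fun r => L * k r)
        (hcw.mono (Icc_subset_Icc ha.1 hdt)) (fun r _ => mul_nonneg hL0 (hk0 r))
        (hkr.mono_set (by
          rw [uIcc_of_le hd.1.le, uIcc_of_le hab.le]; exact Icc_subset_Icc_right hd.2))
        (fun r _ => norm_nonneg _) hdk ?_ d ⟨hd.1.le, le_rfl⟩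
      · simp only [mul_zero] at key
        exact le_antisymm key (norm_nonneg _)
      · intro τ hτ
        have := hinc a τ ha.1 hτ.1 (hτ.2.trans hdt)
        rwa [show w a = 0 from ha0] at this
  have := hmain ⟨ht.1, le_rfl⟩
  exact sub_eq_zero.1 (norm_eq_zero.1 this)
end abstractODE

lemma comp_meas {X Y : Type*} [TopologicalSpace X] [MeasurableSpace X] [BorelSpace X]
    [NormedAddCommGroup Y] [SecondCountableTopology Y] [MeasurableSpace Y] [BorelSpace Y]
    {f : X → Y} {s : Set X} (hf : ContinuousOn f s) (hs : MeasurableSet s)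
    {h : ℝ → X} {μ : Measure ℝ} (hh : AEMeasurable h μ) (hhs : ∀ᵐ r ∂μ, h r ∈ s) :
    AEStronglyMeasurable (fun r => f (h r)) μ := by
  classical
  have h1 : Measurable (s.piecewise f (fun _ => 0)) :=
    hf.measurable_piecewise continuousOn_const hs
  refine AEMeasurable.aestronglyMeasurable ?_
  refine (h1.comp_aemeasurable hh).congr ?_
  filter_upwards [hhs] with r hr
  simp [hr]

lemma ac_continuousOn {E : Type*} [NormedAddCommGroup E] [NormedSpace ℝ E] {f : ℝ → E} {T : ℝ}
    (h : ACloc f T) {t : ℝ} (ht : t ∈ Ico (0:ℝ) T) : ContinuousOn f (Icc 0 t) := by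
  have h1 := intervalIntegral.continuousOn_primitive_interval' (h t ht).1 left_mem_uIcc
  rw [uIcc_of_le ht.1] at h1
  exact ((continuousOn_const (c := f 0)).add h1).congr (h t ht).2

lemma cara_unique {n m q : ℕ}
    (U : Set (EuclideanSpace ℝ (Fin m))) (V : Set (EuclideanSpace ℝ (Fin q)))
    (g0 : EuclideanSpace ℝ (Fin n) → EuclideanSpace ℝ (Fin m) → EuclideanSpace ℝ (Fin q) →
      EuclideanSpace ℝ (Fin n))
    (g : Fin m → EuclideanSpace ℝ (Fin n) → EuclideanSpace ℝ (Fin m) →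
      EuclideanSpace ℝ (Fin n))
    (M : ℝ) (hst : StandingHyp U V g0 g M)
    (x0bar : EuclideanSpace ℝ (Fin n)) (T : ℝ)
    (u : ℝ → EuclideanSpace ℝ (Fin m))
    (huU : ∀ t ∈ Ico (0:ℝ) T, u t ∈ U) (huAC : ACloc u T)
    (v : ℝ → EuclideanSpace ℝ (Fin q)) (hvmeas : Measurable v)
    (hvV : ∀ t ∈ Ico (0:ℝ) T, v t ∈ V)
    (x y : ℝ → EuclideanSpace ℝ (Fin n)) (hx : IsCaraSol g0 g x0bar u v x (Ico 0 T))
    (hy : IsCaraSol g0 g x0bar u v y (Ico 0 T)) (t : ℝ) (ht : t ∈ Ico (0:ℝ) T) : x t = y t := by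
  obtain ⟨hU, hV, hg0c, hg0l, hgl, hM, hgrow⟩ := hst
  obtain ⟨B', hB'⟩ := hU.isBounded.exists_norm_le
  obtain ⟨B, hB0, hB⟩ : ∃ B : ℝ, 0 ≤ B ∧ ∀ z ∈ U, ‖z‖ ≤ B :=
    ⟨max B' 0, le_max_right _ _, fun z hz => (hB' z hz).trans (le_max_left _ _)⟩
  have hgb : ∀ (z : EuclideanSpace ℝ (Fin n)), ∀ u' ∈ U, ∀ v' ∈ V,
      Real.sqrt (‖g0 z u' v'‖ ^ 2 + ∑ i, ‖g i z u'‖ ^ 2) ≤ M * (1 + B) * (1 + ‖z‖) := by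
    intro z u' hu' v' hv'
    refine (hgrow z u' hu' v' hv').trans ?_
    have h1 : Real.sqrt (‖z‖ ^ 2 + ‖u'‖ ^ 2) ≤ ‖z‖ + ‖u'‖ := by
      apply Real.sqrt_le_iff.2 ⟨by positivity, ?_⟩
      nlinarith [mul_nonneg (norm_nonneg z) (norm_nonneg u')]
    have h2 := hB u' hu'
    rw [mul_assoc]
    apply mul_le_mul_of_nonneg_left _ hM.le
    nlinarith [mul_nonneg hB0 (norm_nonneg z)]
  have hg0b : ∀ (z : EuclideanSpace ℝ (Fin n)), ∀ u' ∈ U, ∀ v' ∈ V,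
      ‖g0 z u' v'‖ ≤ M * (1 + B) * (1 + ‖z‖) := by
    intro z u' hu' v' hv'
    refine le_trans (Real.le_sqrt_of_sq_le ?_) (hgb z u' hu' v' hv')
    have : 0 ≤ ∑ i, ‖g i z u'‖ ^ 2 := Finset.sum_nonneg fun i _ => by positivity
    linarith
  have hgib : ∀ (z : EuclideanSpace ℝ (Fin n)), ∀ u' ∈ U, ∀ v' ∈ V, ∀ i,
      ‖g i z u'‖ ≤ M * (1 + B) * (1 + ‖z‖) := by
    intro z u' hu' v' hv' i
    refine le_trans (Real.le_sqrt_of_sq_le ?_) (hgb z u' hu' v' hv')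
    have : ‖g i z u'‖ ^ 2 ≤ ∑ i, ‖g i z u'‖ ^ 2 :=
      Finset.single_le_sum (f := fun i => ‖g i z u'‖ ^ 2) (fun i _ => by positivity)
        (Finset.mem_univ i)
    nlinarith [sq_nonneg ‖g0 z u' v'‖]
  have hgic : ∀ i, ContinuousOn (fun p : EuclideanSpace ℝ (Fin n) × EuclideanSpace ℝ (Fin m) =>
      g i p.1 p.2) (univ ×ˢ U) := by
    intro i p hp
    obtain ⟨L, hL0, hL⟩ := hgl i (‖p.1‖ + 1) (by positivity)
    have h0 : Tendsto (fun z : EuclideanSpace ℝ (Fin n) × EuclideanSpace ℝ (Fin m) =>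
        L * (‖z.1 - p.1‖ + ‖z.2 - p.2‖)) (𝓝[univ ×ˢ U] p) (𝓝 0) := by
      have : Continuous (fun z : EuclideanSpace ℝ (Fin n) × EuclideanSpace ℝ (Fin m) =>
        L * (‖z.1 - p.1‖ + ‖z.2 - p.2‖)) := by fun_prop
      have h := this.tendsto p
      simp only [sub_self, norm_zero, add_zero, mul_zero] at h
      exact h.mono_left nhdsWithin_le_nhds
    have h1 : ∀ᶠ z : EuclideanSpace ℝ (Fin n) × EuclideanSpace ℝ (Fin m) in 𝓝[univ ×ˢ U] p,
        ‖z.1‖ < ‖p.1‖ + 1 := by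
      apply mem_nhdsWithin_of_mem_nhds
      have : Continuous (fun z : EuclideanSpace ℝ (Fin n) × EuclideanSpace ℝ (Fin m) => ‖z.1‖) := by
        fun_prop
      exact this.continuousAt.eventually_lt_const (by simp)
    rw [ContinuousWithinAt, tendsto_iff_norm_sub_tendsto_zero]
    refine squeeze_zero' (Eventually.of_forall fun _ => norm_nonneg _) ?_ h0
    filter_upwards [h1, self_mem_nhdsWithin] with z hz hzU
    exact hL _ _ _ hzU.2 _ hp.2 hz.le (by linarith)
  have hcoord : ∀ (r : ℝ) i, ‖(deriv u r) i‖ ≤ ‖deriv u r‖ := fun r i =>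
    PiLp.norm_apply_le (deriv u r) i
  set C : ℝ := M * (1 + B) * (1 + m) with hC
  have hCpos : 0 < C := by positivity
  refine sol_unique (fun r z => g0 z (u r) (v r) + ∑ i, ((deriv u r) i) • g i z (u r))
    (fun r => C * (1 + ‖deriv u r‖)) T x0bar ?_ ?_ ?_ ?_ ?_ x y hx hy t ht
  · intro t ht z hz
    have hmem : ∀ᵐ r ∂(volume.restrict (Ioc 0 t)), r ∈ Ioc 0 t := ae_restrict_mem measurableSet_Ioc
    have hum : AEMeasurable u (volume.restrict (Ioc 0 t)) :=
      (((ac_continuousOn huAC ht).mono Ioc_subset_Icc_self).aestronglyMeasurable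
        measurableSet_Ioc).aemeasurable
    have hdm : AEStronglyMeasurable (deriv u) (volume.restrict (Ioc 0 t)) := by
      have := (huAC t ht).1
      rw [intervalIntegrable_iff_integrableOn_Ioc_of_le ht.1] at this
      exact this.aestronglyMeasurable
    apply AEStronglyMeasurable.add
    · exact comp_meas hg0c ((MeasurableSet.univ.prod hU.measurableSet).prod hV.measurableSet)
        (h := fun r => ((z r, u r), v r))
        ((hz.aemeasurable.prodMk hum).prodMk hvmeas.aemeasurable) (by
          filter_upwards [hmem] with r hr
          have hr' : r ∈ Ico 0 T := ⟨hr.1.le, hr.2.trans_lt ht.2⟩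
          exact ⟨⟨mem_univ _, huU r hr'⟩, hvV r hr'⟩)
    · apply Finset.aestronglyMeasurable_fun_sum
      intro i _
      apply AEStronglyMeasurable.fun_smul
      · have : Continuous (fun z : EuclideanSpace ℝ (Fin m) => z i) := by fun_prop
        exact this.comp_aestronglyMeasurable hdm
      · exact comp_meas (hgic i) (MeasurableSet.univ.prod hU.measurableSet)
          (h := fun r => (z r, u r)) (hz.aemeasurable.prodMk hum) (by
          filter_upwards [hmem] with r hr
          have hr' : r ∈ Ico 0 T := ⟨hr.1.le, hr.2.trans_lt ht.2⟩
          exact ⟨mem_univ _, huU r hr'⟩)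
  · intro r; positivity
  · intro t ht
    exact (intervalIntegrable_const.add (huAC t ht).1.norm).const_mul C
  · intro r hr z
    have hur := huU r hr
    have hvr := hvV r hr
    have h1 : ‖∑ i, ((deriv u r) i) • g i z (u r)‖ ≤
        ∑ i : Fin m, ‖deriv u r‖ * (M * (1 + B) * (1 + ‖z‖)) := by
      refine norm_sum_le_of_le _ fun i _ => ?_
      rw [norm_smul]
      exact mul_le_mul (hcoord r i) (hgib z _ hur _ hvr i) (norm_nonneg _) (norm_nonneg _)
    simp only [Finset.sum_const, Finset.card_univ, Fintype.card_fin, nsmul_eq_mul] at h1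
    refine (norm_add_le _ _).trans ((add_le_add (hg0b z _ hur _ hvr) h1).trans ?_)
    have hA : 0 ≤ M * (1 + B) * (1 + ‖z‖) := by positivity
    have hm0 : (0:ℝ) ≤ m := Nat.cast_nonneg m
    have hd := norm_nonneg (deriv u r)
    have : C * (1 + ‖deriv u r‖) * (1 + ‖z‖) =
      (M * (1 + B) * (1 + ‖z‖)) * ((1 + m) * (1 + ‖deriv u r‖)) := by rw [hC]; ring
    rw [this]
    have : M * (1 + B) * (1 + ‖z‖) + m * (‖deriv u r‖ * (M * (1 + B) * (1 + ‖z‖))) =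
      (M * (1 + B) * (1 + ‖z‖)) * (1 + m * ‖deriv u r‖) := by ring
    rw [this]
    apply mul_le_mul_of_nonneg_left _ hA
    nlinarith
  · intro R hR
    obtain ⟨L0, hL00, hL0⟩ := hg0l R hR
    choose Li hLi0 hLi using fun i => hgl i R hR
    have hsum : 0 ≤ ∑ i, Li i := Finset.sum_nonneg fun i _ => hLi0 i
    refine ⟨(L0 + ∑ i, Li i) / C, by positivity, ?_⟩
    intro r hr y1 y2 h1 h2
    have hur := huU r hr
    have hvr := hvV r hr
    have e0 := hL0 _ hvr y1 y2 _ hur _ hur h1 h2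
    have ei := fun i => hLi i y1 y2 _ hur _ hur h1 h2
    simp only [sub_self, norm_zero, add_zero] at e0 ei
    have e : g0 y1 (u r) (v r) + ∑ i, ((deriv u r) i) • g i y1 (u r) -
        (g0 y2 (u r) (v r) + ∑ i, ((deriv u r) i) • g i y2 (u r)) =
        (g0 y1 (u r) (v r) - g0 y2 (u r) (v r)) +
          ∑ i, ((deriv u r) i) • (g i y1 (u r) - g i y2 (u r)) := by
      simp only [smul_sub, Finset.sum_sub_distrib]; abel
    have hs : ‖∑ i, ((deriv u r) i) • (g i y1 (u r) - g i y2 (u r))‖ ≤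
        ∑ i : Fin m, ‖deriv u r‖ * (Li i * ‖y1 - y2‖) := by
      refine norm_sum_le_of_le _ fun i _ => ?_
      rw [norm_smul]
      exact mul_le_mul (hcoord r i) (ei i) (norm_nonneg _) (norm_nonneg _)
    rw [← Finset.mul_sum, ← Finset.sum_mul] at hs
    rw [e]
    refine (norm_add_le _ _).trans ((add_le_add e0 hs).trans ?_)
    have : (L0 + ∑ i, Li i) / C * (C * (1 + ‖deriv u r‖)) * ‖y1 - y2‖ =
      (L0 + ∑ i, Li i) * (1 + ‖deriv u r‖) * ‖y1 - y2‖ := by field_simp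
    rw [this]
    have hd := norm_nonneg (deriv u r)
    have hy0 := norm_nonneg (y1 - y2)
    have : L0 * ‖y1 - y2‖ + ‖deriv u r‖ * ((∑ i, Li i) * ‖y1 - y2‖) =
      (L0 + (∑ i, Li i) * ‖deriv u r‖) * ‖y1 - y2‖ := by ring
    rw [this]
    apply mul_le_mul_of_nonneg_right _ hy0
    nlinarith [mul_nonneg hL00 hd]

/-- Proposition 1.1 (i) (arc-length graph parametrization): the arc-length
reparametrization of an AC_loc trajectory-control pair is a feasible space-time
trajectory-control pair. -/
theorem stmt12 {n m q : ℕ}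
    (U : Set (EuclideanSpace ℝ (Fin m))) (V : Set (EuclideanSpace ℝ (Fin q)))
    (g0 : EuclideanSpace ℝ (Fin n) → EuclideanSpace ℝ (Fin m) → EuclideanSpace ℝ (Fin q) →
      EuclideanSpace ℝ (Fin n))
    (g : Fin m → EuclideanSpace ℝ (Fin n) → EuclideanSpace ℝ (Fin m) →
      EuclideanSpace ℝ (Fin n))
    (M : ℝ) (hst : StandingHyp U V g0 g M)
    (x0bar : EuclideanSpace ℝ (Fin n)) (u0bar : EuclideanSpace ℝ (Fin m))
    (T : ℝ) (hT : 0 < T)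
    -- the control (u,v) : u ∈ AC_loc with u(0) = ū₀, v Borel measurable
    (u : ℝ → EuclideanSpace ℝ (Fin m)) (hu0 : u 0 = u0bar)
    (huU : ∀ t ∈ Ico (0:ℝ) T, u t ∈ U) (huAC : ACloc u T)
    (v : ℝ → EuclideanSpace ℝ (Fin q)) (hvmeas : Measurable v)
    (hvV : ∀ t ∈ Ico (0:ℝ) T, v t ∈ V)
    -- x : the Carathéodory solution corresponding to (u,v)
    (x : ℝ → EuclideanSpace ℝ (Fin n)) (hx : IsCaraSol g0 g x0bar u v x (Ico 0 T))
    -- σ(t) := ∫₀ᵗ (1+|u̇(τ)|) dτ and S := lim_{t→T} σ(t) (≤ +∞)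
    (sig : ℝ → ℝ) (hsig : ∀ t ∈ Ico (0:ℝ) T, sig t = ∫ r in (0:ℝ)..t, (1 + ‖deriv u r‖))
    (S : ℝ≥0∞) (hS : S = ⨆ t ∈ Ico (0:ℝ) T, ENNReal.ofReal (sig t))
    (D : Set ℝ) (hD : D = {s : ℝ | 0 ≤ s ∧ ENNReal.ofReal s < S})
    -- φ₀ := σ⁻¹
    (phi0 : ℝ → ℝ) (hphi0inv : ∀ t ∈ Ico (0:ℝ) T, phi0 (sig t) = t)
    (hphi0maps : ∀ s ∈ D, phi0 s ∈ Ico (0:ℝ) T)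
    -- ξ : the space-time solution corresponding to (φ₀, u∘φ₀, v∘φ₀)
    (xi : ℝ → EuclideanSpace ℝ (Fin n))
    (hxi : IsSTSol g0 g x0bar phi0 (fun s => u (phi0 s)) (fun s => v (phi0 s)) xi D) :
    -- (φ₀,φ) is 1-Lipschitz
    (∀ s1 ∈ D, ∀ s2 ∈ D,
      |phi0 s1 - phi0 s2| + ‖u (phi0 s1) - u (phi0 s2)‖ ≤ |s1 - s2|) ∧
    -- φ₀ is strictly increasing with φ₀(0) = 0
    StrictMonoOn phi0 D ∧ phi0 0 = 0 ∧
    -- φ₀' + |φ'| = 1 a.e. on [0,S)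
    (∀ᵐ s ∂volume, s ∈ D → deriv phi0 s + ‖deriv (fun r => u (phi0 r)) s‖ = 1) ∧
    -- lim_{s→S} φ₀(s) = T
    (∀ ε > (0:ℝ), ∃ s0 ∈ D, ∀ s ∈ D, s0 ≤ s → |phi0 s - T| < ε) ∧
    -- (ξ,φ,ψ) ∘ σ = (x,u,v)
    (∀ t ∈ Ico (0:ℝ) T,
      xi (sig t) = x t ∧ u (phi0 (sig t)) = u t ∧ v (phi0 (sig t)) = v t) := by
  have hint : ∀ a ∈ Ico (0:ℝ) T, ∀ b ∈ Ico (0:ℝ) T,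
      IntervalIntegrable (fun r => 1 + ‖deriv u r‖) volume a b := by
    intro a ha b hb
    have h1 := (huAC a ha).1.symm.trans (huAC b hb).1
    exact intervalIntegrable_const.add h1.norm
  have hzero : (0:ℝ) ∈ Ico 0 T := ⟨le_rfl, hT⟩
  have hsig0 : sig 0 = 0 := by rw [hsig 0 hzero]; simp
  have hdiff : ∀ a ∈ Ico (0:ℝ) T, ∀ b ∈ Ico (0:ℝ) T, a ≤ b →
      (b - a) + ‖u b - u a‖ ≤ sig b - sig a := by
    intro a ha b hb hab
    have h1 := (huAC a ha).1.symm.trans (huAC b hb).1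
    have e1 : sig b - sig a = (b - a) + ∫ r in a..b, ‖deriv u r‖ := by
      rw [hsig b hb, hsig a ha,
        intervalIntegral.integral_interval_sub_left (hint 0 hzero b hb) (hint 0 hzero a ha),
        intervalIntegral.integral_add intervalIntegrable_const h1.norm]
      simp
    have e2 : u b - u a = ∫ r in a..b, deriv u r := by
      rw [(huAC b hb).2 b ⟨hb.1, le_rfl⟩, (huAC a ha).2 a ⟨ha.1, le_rfl⟩, add_sub_add_left_eq_sub,
        intervalIntegral.integral_interval_sub_left (huAC b hb).1 (huAC a ha).1]
    rw [e1, e2]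
    have := intervalIntegral.norm_integral_le_integral_norm (f := deriv u) (μ := volume) hab
    linarith
  have hmono : StrictMonoOn sig (Ico 0 T) := by
    intro a ha b hb hab
    have := hdiff a ha b hb hab.le
    have := norm_nonneg (u b - u a)
    linarith
  have hcont : ∀ t ∈ Ico (0:ℝ) T, ContinuousOn sig (Icc 0 t) := by
    intro t ht
    have h1 := intervalIntegral.continuousOn_primitive_interval' (hint 0 hzero t ht) left_mem_uIcc
    rw [uIcc_of_le ht.1] at h1
    exact h1.congr fun τ hτ => hsig τ ⟨hτ.1, hτ.2.trans_lt ht.2⟩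
  have hsign : ∀ t ∈ Ico (0:ℝ) T, 0 ≤ sig t := by
    intro t ht
    rw [← hsig0]; exact hmono.monotoneOn hzero ht ht.1
  have hsigD : ∀ t ∈ Ico (0:ℝ) T, sig t ∈ D := by
    intro t ht
    obtain ⟨t', h1, h2⟩ := exists_between ht.2
    have ht' : t' ∈ Ico 0 T := ⟨ht.1.trans h1.le, h2⟩
    rw [hD]
    refine ⟨hsign t ht, ?_⟩
    have hlt := hmono ht ht' h1
    have : ENNReal.ofReal (sig t) < ENNReal.ofReal (sig t') :=
      (ENNReal.ofReal_lt_ofReal_iff ((hsign t ht).trans_lt hlt)).2 hlt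
    refine this.trans_le ?_
    rw [hS]
    exact le_iSup₂ (f := fun t (_ : t ∈ Ico (0:ℝ) T) => ENNReal.ofReal (sig t)) t' ht'
  have hDsig : ∀ s ∈ D, ∃ t ∈ Ico (0:ℝ) T, sig t = s := by
    intro s hs
    rw [hD, hS] at hs
    obtain ⟨hs0, hs1⟩ := hs
    obtain ⟨t, h1⟩ := lt_iSup_iff.1 hs1
    obtain ⟨ht, h2⟩ := lt_iSup_iff.1 h1
    have h3 : s < sig t := by
      by_contra h
      exact absurd h2 (not_lt.2 (ENNReal.ofReal_le_ofReal (not_lt.1 h)))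
    obtain ⟨τ, hτ, e⟩ := intermediate_value_Icc ht.1 (hcont t ht)
      (show s ∈ Icc (sig 0) (sig t) by rw [hsig0]; exact ⟨hs0, h3.le⟩)
    exact ⟨τ, ⟨hτ.1, hτ.2.trans_lt ht.2⟩, e⟩
  have hinv : ∀ s ∈ D, sig (phi0 s) = s := by
    intro s hs
    obtain ⟨t, ht, rfl⟩ := hDsig s hs
    rw [hphi0inv t ht]
  have hphi00 : phi0 0 = 0 := by
    have := hphi0inv 0 hzero
    rwa [hsig0] at this
  have hphimono : StrictMonoOn phi0 D := by
    intro s1 h1 s2 h2 h12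
    obtain ⟨t1, ht1, rfl⟩ := hDsig s1 h1
    obtain ⟨t2, ht2, rfl⟩ := hDsig s2 h2
    rw [hphi0inv t1 ht1, hphi0inv t2 ht2]
    exact (hmono.lt_iff_lt ht1 ht2).1 h12
  have hlip : ∀ s1 ∈ D, ∀ s2 ∈ D,
      |phi0 s1 - phi0 s2| + ‖u (phi0 s1) - u (phi0 s2)‖ ≤ |s1 - s2| := by
    intro s1 h1 s2 h2
    obtain ⟨t1, ht1, rfl⟩ := hDsig s1 h1
    obtain ⟨t2, ht2, rfl⟩ := hDsig s2 h2
    rw [hphi0inv t1 ht1, hphi0inv t2 ht2]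
    rcases le_total t1 t2 with h | h
    · have := hdiff t1 ht1 t2 ht2 h
      rw [abs_sub_comm t1, norm_sub_rev, abs_of_nonneg (sub_nonneg.2 h), abs_sub_comm]
      exact this.trans (le_abs_self _)
    · have := hdiff t2 ht2 t1 ht1 h
      rw [abs_of_nonneg (sub_nonneg.2 h)]
      exact this.trans (le_abs_self _)
  have hIooD : ∀ t ∈ Ico (0:ℝ) T, Ioo 0 (sig t) ⊆ D := by
    intro t ht s hs
    have h := hsigD t ht
    rw [hD] at h ⊢
    exact ⟨hs.1.le, (ENNReal.ofReal_le_ofReal hs.2.le).trans_lt h.2⟩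
  -- the good set of times
  have hgood : ∀ t ∈ Ico (0:ℝ) T, ∃ A : Set ℝ, A ⊆ Ioo 0 t ∧ MeasurableSet A ∧
      A =ᵐ[volume] Ioo 0 t ∧ (∀ τ ∈ A, HasDerivAt u (deriv u τ) τ) ∧
      (∀ τ ∈ A, HasDerivAt sig (1 + ‖deriv u τ‖) τ) := by
    intro t ht
    have a1 := (huAC t ht).1.ae_hasDerivAt_integral
    have a2 := (hint 0 hzero t ht).ae_hasDerivAt_integral
    rw [uIcc_of_le ht.1] at a1 a2
    have a3 : ∀ᵐ τ : ℝ, τ ∈ Ioo 0 t → HasDerivAt u (deriv u τ) τ ∧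
        HasDerivAt sig (1 + ‖deriv u τ‖) τ := by
      filter_upwards [a1, a2] with τ h1 h2 hτ
      have hτ' := Ioo_subset_Icc_self hτ
      have hn : Icc 0 t ∈ 𝓝 τ := Icc_mem_nhds hτ.1 hτ.2
      constructor
      · refine ((h1 hτ' 0 ⟨le_rfl, ht.1⟩).const_add (u 0)).congr_of_eventuallyEq ?_
        filter_upwards [hn] with z hz
        exact (huAC t ht).2 z hz
      · refine (h2 hτ' 0 ⟨le_rfl, ht.1⟩).congr_of_eventuallyEq ?_
        filter_upwards [hn] with z hz
        exact hsig z ⟨hz.1, hz.2.trans_lt ht.2⟩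
    set Bad : Set ℝ := {τ : ℝ | ¬ (τ ∈ Ioo 0 t → HasDerivAt u (deriv u τ) τ ∧
        HasDerivAt sig (1 + ‖deriv u τ‖) τ)} with hBad
    have hBad0 : volume (toMeasurable volume Bad) = 0 := by
      rw [measure_toMeasurable]; exact a3
    have hg : ∀ τ ∈ Ioo 0 t \ toMeasurable volume Bad, HasDerivAt u (deriv u τ) τ ∧
        HasDerivAt sig (1 + ‖deriv u τ‖) τ := by
      intro τ hτ
      by_contra hc
      exact hτ.2 (subset_toMeasurable _ _ (fun h => hc (h hτ.1)))
    refine ⟨Ioo 0 t \ toMeasurable volume Bad, sdiff_subset,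
      measurableSet_Ioo.diff (measurableSet_toMeasurable _ _), sdiff_null_ae_eq_self hBad0,
      fun τ hτ => (hg τ hτ).1, fun τ hτ => (hg τ hτ).2⟩
  have himage : ∀ t ∈ Ico (0:ℝ) T, ∀ A : Set ℝ, A ⊆ Ioo 0 t → MeasurableSet A →
      A =ᵐ[volume] Ioo 0 t → (∀ τ ∈ A, HasDerivAt sig (1 + ‖deriv u τ‖) τ) →
      sig '' A =ᵐ[volume] Ioo 0 (sig t) := by
    intro t ht A hAs hAm hAe hAd
    have hinj : InjOn sig A := hmono.injOn.mono
      (show A ⊆ Ico 0 T from fun τ hτ => ⟨(hAs hτ).1.le, (hAs hτ).2.trans ht.2⟩)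
    have h1 := lintegral_image_eq_lintegral_abs_deriv_mul hAm
      (fun τ hτ => (hAd τ hτ).hasDerivWithinAt) hinj (fun _ => 1)
    apply ae_eq_of_subset_of_measure_ge
    · rintro _ ⟨τ, hτ, rfl⟩
      have hτ' : τ ∈ Ico 0 T := ⟨(hAs hτ).1.le, (hAs hτ).2.trans ht.2⟩
      refine ⟨?_, hmono hτ' ht (hAs hτ).2⟩
      rw [← hsig0]; exact hmono hzero hτ' (hAs hτ).1
    · rw [Real.volume_Ioo, sub_zero, ← setLIntegral_one (sig '' A), h1]
      have h2 := hint 0 hzero t ht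
      rw [hsig t ht, intervalIntegral.integral_of_le ht.1, integral_Ioc_eq_integral_Ioo,
        ← setIntegral_congr_set hAe, ofReal_integral_eq_lintegral_ofReal]
      · apply le_of_eq
        apply lintegral_congr
        intro r
        rw [abs_of_nonneg (by positivity), mul_one]
      · rw [intervalIntegrable_iff_integrableOn_Ioc_of_le ht.1] at h2
        exact h2.mono_set (hAs.trans Ioo_subset_Ioc_self)
      · exact Eventually.of_forall fun r => by positivity
    · exact (hAm.image_of_continuousOn_injOn
        (fun τ hτ => (hAd τ hτ).continuousAt.continuousWithinAt) hinj).nullMeasurableSet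
    · simp
  have hphid : ∀ t ∈ Ico (0:ℝ) T, ∀ τ ∈ Ioo 0 t, HasDerivAt u (deriv u τ) τ →
      HasDerivAt sig (1 + ‖deriv u τ‖) τ →
      HasDerivAt phi0 (1 + ‖deriv u τ‖)⁻¹ (sig τ) ∧
      HasDerivAt (fun s => u (phi0 s)) ((1 + ‖deriv u τ‖)⁻¹ • deriv u τ) (sig τ) := by
    intro t ht τ hτ h1 h2
    have hτ' : τ ∈ Ico 0 T := ⟨hτ.1.le, hτ.2.trans ht.2⟩
    have hmem : sig τ ∈ Ioo 0 (sig t) :=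
      ⟨by rw [← hsig0]; exact hmono hzero hτ' hτ.1, hmono hτ' ht hτ.2⟩
    have hDn : D ∈ 𝓝 (sig τ) := mem_of_superset (Ioo_mem_nhds hmem.1 hmem.2) (hIooD t ht)
    have hc : ContinuousAt phi0 (sig τ) := by
      have : LipschitzOnWith 1 phi0 D := LipschitzOnWith.of_dist_le_mul fun a ha b hb => by
        have := hlip a ha b hb
        have h0 := norm_nonneg (u (phi0 a) - u (phi0 b))
        simp only [Real.dist_eq, NNReal.coe_one, one_mul]
        linarith
      exact this.continuousOn.continuousAt hDn
    have e := hphi0inv τ hτ'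
    have hd : HasDerivAt phi0 (1 + ‖deriv u τ‖)⁻¹ (sig τ) := by
      apply HasDerivAt.of_local_left_inverse hc (f := sig)
      · rw [e]; exact h2
      · positivity
      · filter_upwards [hDn] with y hy using hinv y hy
    refine ⟨hd, ?_⟩
    rw [← e] at h1
    have := h1.scomp (sig τ) (h := phi0) (h' := (1 + ‖deriv u τ‖)⁻¹) hd
    rw [e] at this
    exact this
  refine ⟨hlip, hphimono, hphi00, ?_, ?_, ?_⟩
  · -- arc-length identity
    have hloc : ∀ t ∈ Ico (0:ℝ) T, ∀ᵐ s : ℝ, s ∈ Ioo 0 (sig t) →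
        deriv phi0 s + ‖deriv (fun r => u (phi0 r)) s‖ = 1 := by
      intro t ht
      obtain ⟨A, hAs, hAm, hAe, hA1, hA2⟩ := hgood t ht
      have him := himage t ht A hAs hAm hAe hA2
      filter_upwards [him.mem_iff] with s hs hsI
      obtain ⟨τ, hτ, rfl⟩ := hs.2 hsI
      obtain ⟨d1, d2⟩ := hphid t ht τ (hAs hτ) (hA1 τ hτ) (hA2 τ hτ)
      have hp : 0 < 1 + ‖deriv u τ‖ := by positivity
      rw [d1.deriv, d2.deriv, norm_smul, Real.norm_of_nonneg (inv_nonneg.2 hp.le)]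
      field_simp
    have htn : ∀ k : ℕ, T - T / (k + 1) ∈ Ico 0 T := by
      intro k
      have hk : (0:ℝ) < k + 1 := by positivity
      refine ⟨?_, by have := div_pos hT hk; linarith⟩
      rw [sub_nonneg, div_le_iff₀ hk]
      have : (0:ℝ) ≤ k := Nat.cast_nonneg k
      nlinarith
    have hall := ae_all_iff.2 fun k : ℕ => hloc _ (htn k)
    have hne : ∀ᵐ s : ℝ, s ≠ 0 := by simp [ae_iff, measure_singleton]
    filter_upwards [hall, hne] with s hs hs0 hsD
    obtain ⟨τ, hτ, rfl⟩ := hDsig s hsD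
    obtain ⟨k, hk⟩ := exists_nat_one_div_lt (div_pos (sub_pos.2 hτ.2) hT)
    have hk' : (0:ℝ) < k + 1 := by positivity
    have hlt : τ < T - T / (k + 1) := by
      rw [lt_div_iff₀ hT] at hk
      have : 1 / ((k:ℝ) + 1) * T = T / (k + 1) := by ring
      linarith
    exact hs k ⟨lt_of_le_of_ne (hsign τ hτ) (Ne.symm hs0), hmono hτ (htn k) hlt⟩
  · -- limit
    intro ε hε
    have hmax : max 0 (T - ε / 2) ∈ Ico 0 T := ⟨le_max_left _ _, max_lt hT (by linarith)⟩
    refine ⟨sig (max 0 (T - ε / 2)), hsigD _ hmax, fun s hs hle => ?_⟩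
    have h1 := hphimono.monotoneOn (hsigD _ hmax) hs hle
    rw [hphi0inv _ hmax] at h1
    have h2 := (hphi0maps s hs).2
    have h3 := le_max_right 0 (T - ε / 2)
    rw [abs_lt]
    constructor <;> linarith
  · intro t ht
    refine ⟨?_, by rw [hphi0inv t ht], by rw [hphi0inv t ht]⟩
    refine cara_unique U V g0 g M hst x0bar T u huU huAC v hvmeas hvV
      (fun t => xi (sig t)) x ?_ hx t ht
    intro t ht
    obtain ⟨A, hAs, hAm, hAe, hA1, hA2⟩ := hgood t ht
    have him := himage t ht A hAs hAm hAe hA2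
    have hinj : InjOn sig A := hmono.injOn.mono
      (show A ⊆ Ico 0 T from fun τ hτ => ⟨(hAs hτ).1.le, (hAs hτ).2.trans ht.2⟩)
    simp only
    rw [hxi (sig t) (hsigD t ht), intervalIntegral.integral_of_le (hsign t ht),
      intervalIntegral.integral_of_le ht.1, integral_Ioc_eq_integral_Ioo,
      integral_Ioc_eq_integral_Ioo, ← setIntegral_congr_set him, ← setIntegral_congr_set hAe,
      integral_image_eq_integral_abs_deriv_smul hAm
        (fun τ hτ => (hA2 τ hτ).hasDerivWithinAt) hinj]
    congr 1
    apply setIntegral_congr_fun hAm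
    intro τ hτ
    have hτ' : τ ∈ Ico 0 T := ⟨(hAs hτ).1.le, (hAs hτ).2.trans ht.2⟩
    obtain ⟨d1, d2⟩ := hphid t ht τ (hAs hτ) (hA1 τ hτ) (hA2 τ hτ)
    have hp : 0 < 1 + ‖deriv u τ‖ := by positivity
    simp only [d1.deriv, d2.deriv, hphi0inv τ hτ', abs_of_pos hp, smul_add, Finset.smul_sum,
      smul_smul, PiLp.smul_apply, smul_eq_mul, mul_inv_cancel₀ hp.ne', one_smul,
      mul_inv_cancel_left₀ hp.ne']
end
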